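/- arXiv:1904.02340 — 3 statements merged into one kernel-verified Lean document; each statement's English description precedes it below -/
import Mathlib

section
/- Theorem 2 (view insufficiency bound, finite version with the sharp Pinsker constant): Let X, A, B be random variables on a probability space taking values in finite types, and let ℓ be a real-valued function of (x, a, b) with |ℓ(x,a,b)| ≤ 1 for all arguments. Then |E[ℓ(X, A, B)] − Σ_{(a,b): P(A=a,B=b)>0} P(A=a, B=b) Σ_x P_{X|A=a}(x) ℓ(x, a, b)| ≤ √(2 · I(X; B | A)). (Here A plays the role of the retained view set S*_m and B of the discarded views S*_M \ S*_m: the expected loss computed under the conditional law of X given only the retained views differs from the true expected loss by at most √(2·I(X; S*_M \ S*_m | S*_m)).) -/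
open MeasureTheory

/-- Shannon entropy of a finitely-valued random variable
(with the convention `0 · log 0 = 0`, automatic since `Real.log 0 = 0`). -/
noncomputable def entropy {Ω S : Type*} [MeasurableSpace Ω] [Fintype S]
    (μ : Measure Ω) (Y : Ω → S) : ℝ :=
  -∑ y : S, (μ (Y ⁻¹' {y})).toReal * Real.log (μ (Y ⁻¹' {y})).toReal

/-- Conditional mutual information
`I(X;Y|Z) = H(X,Z) + H(Y,Z) − H(X,Y,Z) − H(Z)`. -/
noncomputable def condMutualInfo {Ω S T U : Type*} [MeasurableSpace Ω]
    [Fintype S] [Fintype T] [Fintype U]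
    (μ : Measure Ω) (X : Ω → S) (Y : Ω → T) (Z : Ω → U) : ℝ :=
  entropy μ (fun ω => (X ω, Z ω)) + entropy μ (fun ω => (Y ω, Z ω))
    - entropy μ (fun ω => (X ω, Y ω, Z ω)) - entropy μ Z

/-- The rational lower bound on `t log t - t + 1` behind the sharp Pinsker inequality. -/
theorem three_mul_sub_one_sq_le {t : ℝ} (ht : 0 < t) :
    3 * (t - 1) ^ 2 ≤ (2 * t + 4) * (t * Real.log t - t + 1) := by
  set f : ℝ → ℝ := fun t => Real.log t - (5 * t ^ 2 - 4 * t - 1) / (2 * (t ^ 2 + 2 * t)) with hf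
  have hder : ∀ u : ℝ, 0 < u → HasDerivAt f ((u - 1) ^ 3 / (u ^ 2 * (u + 2) ^ 2)) u := by
    intro u hu
    have hnum : HasDerivAt (fun t : ℝ => 5 * t ^ 2 - 4 * t - 1) (10 * u - 4) u := by
      have h := ((((hasDerivAt_id u).pow 2).const_mul 5).sub
        ((hasDerivAt_id u).const_mul 4)).sub_const 1
      refine h.congr_deriv ?_
      simp only [id]
      ring
    have hden : HasDerivAt (fun t : ℝ => 2 * (t ^ 2 + 2 * t)) (4 * u + 4) u := by
      have h := (((hasDerivAt_id u).pow 2).add ((hasDerivAt_id u).const_mul 2)).const_mul 2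
      refine h.congr_deriv ?_
      simp only [id]
      ring
    refine ((Real.hasDerivAt_log hu.ne').sub (hnum.div hden (by positivity))).congr_deriv ?_
    field_simp
    ring
  have hf1 : f 1 = 0 := by norm_num [hf]
  have hnonneg : 0 ≤ f t := by
    rcases le_total 1 t with h | h
    · have hmono : MonotoneOn f (Set.Ici 1) := by
        refine monotoneOn_of_deriv_nonneg (convex_Ici 1) ?_ ?_ ?_
        · exact fun u hu => (hder u (one_pos.trans_le hu)).continuousAt.continuousWithinAt
        · intro u hu
          rw [interior_Ici] at hu
          exact (hder u (one_pos.trans hu)).differentiableAt.differentiableWithinAt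
        · intro u hu
          rw [interior_Ici, Set.mem_Ioi] at hu
          rw [(hder u (one_pos.trans hu)).deriv]
          have : 0 ≤ u - 1 := by linarith
          positivity
      simpa [hf1] using hmono Set.self_mem_Ici h h
    · have hanti : AntitoneOn f (Set.Ioc 0 1) := by
        refine antitoneOn_of_deriv_nonpos (convex_Ioc 0 1) ?_ ?_ ?_
        · exact fun u hu => (hder u hu.1).continuousAt.continuousWithinAt
        · intro u hu
          rw [interior_Ioc] at hu
          exact (hder u hu.1).differentiableAt.differentiableWithinAt
        · intro u hu
          rw [interior_Ioc] at hu
          rw [(hder u hu.1).deriv]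
          refine div_nonpos_of_nonpos_of_nonneg ?_ (by positivity)
          exact Odd.pow_nonpos (by decide) (by linarith [hu.2])
      simpa [hf1] using hanti ⟨ht, h⟩ ⟨one_pos, le_rfl⟩ h
  have hmul : 0 ≤ (2 * t + 4) * t * f t := by positivity
  have hexpand : (2 * t + 4) * t * f t =
      (2 * t + 4) * (t * Real.log t - t + 1) - 3 * (t - 1) ^ 2 := by
    simp only [hf]
    field_simp
    ring
  linarith

theorem three_mul_sub_sq_le {p q : ℝ} (hp : 0 ≤ p) (hq : 0 ≤ q) (hpq : q = 0 → p = 0) :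
    3 * (p - q) ^ 2 ≤ (2 * p + 4 * q) * (p * Real.log (p / q) - p + q) := by
  rcases hq.eq_or_lt with rfl | hq
  · simp [hpq rfl]
  rcases hp.eq_or_lt with rfl | hp
  · nlinarith [sq_nonneg q]
  have h := mul_le_mul_of_nonneg_left (three_mul_sub_one_sq_le (div_pos hp hq)) (sq_nonneg q)
  generalize Real.log (p / q) = l at h ⊢
  have hl : q ^ 2 * (3 * (p / q - 1) ^ 2) = 3 * (p - q) ^ 2 := by field_simp
  have hr : q ^ 2 * ((2 * (p / q) + 4) * (p / q * l - p / q + 1)) =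
      (2 * p + 4 * q) * (p * l - p + q) := by field_simp
  linarith

/-- Pinsker's inequality on a finite type. -/
theorem sq_sum_abs_sub_le_two_mul_sum_log {ι : Type*} [Fintype ι] {p q : ι → ℝ}
    (hp : ∀ i, 0 ≤ p i) (hq : ∀ i, 0 ≤ q i) (hpq : ∀ i, q i = 0 → p i = 0)
    (hp1 : ∑ i, p i = 1) (hq1 : ∑ i, q i = 1) :
    (∑ i, |p i - q i|) ^ 2 ≤ 2 * ∑ i, p i * Real.log (p i / q i) := by
  have hkey := fun i => three_mul_sub_sq_le (hp i) (hq i) (hpq i)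
  have hw : ∀ i, 0 ≤ 2 * p i + 4 * q i := fun i => by linarith [hp i, hq i]
  have hd : ∀ i, 0 ≤ p i * Real.log (p i / q i) - p i + q i := by
    intro i
    rcases (hw i).eq_or_lt with h | h
    · have hpi : p i = 0 := by linarith [hp i, hq i]
      have hqi : q i = 0 := by linarith [hp i, hq i]
      simp [hpi, hqi]
    · exact nonneg_of_mul_nonneg_right ((by positivity : (0 : ℝ) ≤ _).trans (hkey i)) h
  have hcs := Finset.sum_sq_le_sum_mul_sum_of_sq_le_mul Finset.univ
    (r := fun i => |p i - q i|) (f := fun i => (2 * p i + 4 * q i) / 3)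
    (g := fun i => p i * Real.log (p i / q i) - p i + q i)
    (fun i _ => by linarith [hw i]) (fun i _ => hd i)
    (fun i _ => by rw [sq_abs]; linarith [hkey i])
  rw [← Finset.sum_div, Finset.sum_add_distrib, Finset.sum_add_distrib, Finset.sum_sub_distrib,
    ← Finset.mul_sum, ← Finset.mul_sum, hp1, hq1] at hcs
  linarith

theorem integral_comp_eq_sum_measureReal {Ω T : Type*} [MeasurableSpace Ω] (μ : Measure Ω)
    [IsProbabilityMeasure μ] [Fintype T] [MeasurableSpace T] [MeasurableSingletonClass T]
    {Y : Ω → T} (hY : Measurable Y) (h : T → ℝ) :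
    ∫ ω, h (Y ω) ∂μ = ∑ y, μ.real (Y ⁻¹' {y}) * h y := by
  have := Measure.isProbabilityMeasure_map (μ := μ) hY.aemeasurable
  rw [← integral_map hY.aemeasurable (Measurable.of_discrete).aestronglyMeasurable,
    integral_fintype (Integrable.of_finite)]
  refine Finset.sum_congr rfl fun y _ => ?_
  rw [map_measureReal_apply hY (measurableSet_singleton y), smul_eq_mul]

theorem entropy_comp_eq_neg_sum {Ω T U : Type*} [MeasurableSpace Ω] (μ : Measure Ω)
    [IsProbabilityMeasure μ] [Fintype T] [MeasurableSpace T] [MeasurableSingletonClass T]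
    [Fintype U] [MeasurableSpace U] [MeasurableSingletonClass U]
    {W : Ω → T} (hW : Measurable W) (g : T → U) :
    entropy μ (fun ω => g (W ω)) =
      -∑ w, μ.real (W ⁻¹' {w}) * Real.log (μ.real ((fun ω => g (W ω)) ⁻¹' {g w})) := by
  have hg : Measurable fun ω => g (W ω) := Measurable.of_discrete.comp hW
  have h := integral_comp_eq_sum_measureReal μ hg
    fun u => Real.log (μ.real ((fun ω => g (W ω)) ⁻¹' {u}))
  have h' := integral_comp_eq_sum_measureReal μ hW
    fun w => Real.log (μ.real ((fun ω => g (W ω)) ⁻¹' {g w}))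
  rw [← h', h]
  rfl

theorem sum_measureReal_prodMk_preimage {Ω T U : Type*} [MeasurableSpace Ω] (μ : Measure Ω)
    [IsProbabilityMeasure μ] [Fintype T] [MeasurableSpace T] [MeasurableSingletonClass T]
    [MeasurableSpace U] [MeasurableSingletonClass U]
    {Y : Ω → T} (hY : Measurable Y) {Z : Ω → U} (hZ : Measurable Z) (z : U) :
    ∑ y, μ.real ((fun ω => (Y ω, Z ω)) ⁻¹' {(y, z)}) = μ.real (Z ⁻¹' {z}) := by
  have hunion : Z ⁻¹' {z} = ⋃ y, Z ⁻¹' {z} ∩ Y ⁻¹' {y} := by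
    ext ω
    simp
  rw [hunion, measureReal_iUnion_fintype]
  · refine Finset.sum_congr rfl fun y _ => ?_
    congr 1
    ext ω
    simp [and_comm]
  · intro y y' hne
    refine Set.disjoint_left.2 fun ω h h' => hne ?_
    exact h.2.symm.trans h'.2
  · exact fun y => (hZ (measurableSet_singleton z)).inter (hY (measurableSet_singleton y))

/-- Theorem 2 (view insufficiency bound, finite version with the sharp Pinsker
constant): for a bounded loss `ℓ` with `|ℓ| ≤ 1`, the true expected loss
`E[ℓ(X,A,B)]` differs from the expected loss computed under the conditional law
of `X` given only the retained views `A` by at most `√(2·I(X; B | A))`. -/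
theorem view_insufficiency_bound
    {Ω S α β : Type*} [MeasurableSpace Ω] (μ : Measure Ω) [IsProbabilityMeasure μ]
    [Fintype S] [MeasurableSpace S] [MeasurableSingletonClass S]
    [Fintype α] [MeasurableSpace α] [MeasurableSingletonClass α]
    [Fintype β] [MeasurableSpace β] [MeasurableSingletonClass β]
    (X : Ω → S) (hX : Measurable X)
    (A : Ω → α) (hA : Measurable A)
    (B : Ω → β) (hB : Measurable B)
    (ℓ : S → α → β → ℝ) (hℓ : ∀ x a b, |ℓ x a b| ≤ 1) :
    |(∫ ω, ℓ (X ω) (A ω) (B ω) ∂μ) -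
        ∑ a : α, ∑ b : β,
          (if 0 < μ ((fun ω => (A ω, B ω)) ⁻¹' {(a, b)}) then
            (μ ((fun ω => (A ω, B ω)) ⁻¹' {(a, b)})).toReal *
              ∑ x : S,
                ((μ ((fun ω => (X ω, A ω)) ⁻¹' {(x, a)})).toReal /
                    (μ (A ⁻¹' {a})).toReal) * ℓ x a b
          else 0)|
      ≤ Real.sqrt (2 * condMutualInfo μ X B A) := by
  set W : Ω → S × β × α := fun ω => (X ω, B ω, A ω) with hWdef
  have hW : Measurable W := hX.prodMk (hB.prodMk hA)
  set p : S × β × α → ℝ := fun w => μ.real (W ⁻¹' {w}) with hp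
  set pXA : S × α → ℝ := fun u => μ.real ((fun ω => (X ω, A ω)) ⁻¹' {u}) with hpXA
  set pBA : β × α → ℝ := fun u => μ.real ((fun ω => (B ω, A ω)) ⁻¹' {u}) with hpBA
  set pA : α → ℝ := fun a => μ.real (A ⁻¹' {a}) with hpA
  set q : S × β × α → ℝ := fun w => pBA w.2 * (pXA (w.1, w.2.2) / pA w.2.2) with hq
  set L : S × β × α → ℝ := fun w => ℓ w.1 w.2.2 w.2.1 with hL
  have hp0 : ∀ w, 0 ≤ p w := fun w => measureReal_nonneg
  have hq0 : ∀ w, 0 ≤ q w := fun w => by positivity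
  have hpXA_le : ∀ w, p w ≤ pXA (w.1, w.2.2) := by
    refine fun w => measureReal_mono fun ω hω => ?_
    obtain rfl : W ω = w := hω
    rfl
  have hpBA_le : ∀ w, p w ≤ pBA w.2 := by
    refine fun w => measureReal_mono fun ω hω => ?_
    obtain rfl : W ω = w := hω
    rfl
  have hpA_le : ∀ w, p w ≤ pA w.2.2 := by
    refine fun w => measureReal_mono fun ω hω => ?_
    obtain rfl : W ω = w := hω
    rfl
  have hpq : ∀ w, q w = 0 → p w = 0 := by
    intro w hw
    by_contra hne
    have hpos := (hp0 w).lt_of_ne' hne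
    have h1 := hpos.trans_le (hpXA_le w)
    have h2 := hpos.trans_le (hpBA_le w)
    have h3 := hpos.trans_le (hpA_le w)
    have : 0 < q w := by positivity
    exact this.ne' hw
  have hp1 : ∑ w, p w = 1 := by
    simpa using (integral_comp_eq_sum_measureReal μ hW fun _ => 1).symm
  have hA1 : ∑ a, pA a = 1 := by
    simpa using (integral_comp_eq_sum_measureReal μ hA fun _ => 1).symm
  have hq1 : ∑ w, q w = 1 := by
    simp only [hq, Fintype.sum_prod_type_right]
    simp_rw [← Finset.mul_sum, ← Finset.sum_div, ← Finset.sum_mul]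
    rw [← hA1]
    refine Finset.sum_congr rfl fun a _ => ?_
    rw [sum_measureReal_prodMk_preimage μ hX hA, sum_measureReal_prodMk_preimage μ hB hA,
      ← mul_div_assoc, mul_self_div_self]
  have hint : ∫ ω, ℓ (X ω) (A ω) (B ω) ∂μ = ∑ w, p w * L w :=
    integral_comp_eq_sum_measureReal μ hW L
  have hcond : (∑ a : α, ∑ b : β,
      (if 0 < μ ((fun ω => (A ω, B ω)) ⁻¹' {(a, b)}) then
        (μ ((fun ω => (A ω, B ω)) ⁻¹' {(a, b)})).toReal *
          ∑ x : S, ((μ ((fun ω => (X ω, A ω)) ⁻¹' {(x, a)})).toReal /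
            (μ (A ⁻¹' {a})).toReal) * ℓ x a b
      else 0)) = ∑ w, q w * L w := by
    simp only [Fintype.sum_prod_type_right]
    refine Finset.sum_congr rfl fun a _ => Finset.sum_congr rfl fun b _ => ?_
    have hswap : (fun ω => (A ω, B ω)) ⁻¹' {(a, b)} = (fun ω => (B ω, A ω)) ⁻¹' {(b, a)} := by
      ext ω
      simp [and_comm]
    rw [hswap]
    split_ifs with h
    · rw [Finset.mul_sum]
      refine Finset.sum_congr rfl fun x _ => ?_
      rw [← mul_assoc]
      rfl
    · have hzero : pBA (b, a) = 0 := by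
        simp [hpBA, Measure.real, nonpos_iff_eq_zero.1 (not_lt.1 h)]
      simp [hq, hzero]
  have hmi : condMutualInfo μ X B A = ∑ w, p w * Real.log (p w / q w) := by
    have hXA := entropy_comp_eq_neg_sum μ hW fun w => (w.1, w.2.2)
    have hBA := entropy_comp_eq_neg_sum μ hW fun w => w.2
    have hXBA := entropy_comp_eq_neg_sum μ hW fun w => w
    have hA' := entropy_comp_eq_neg_sum μ hW fun w => w.2.2
    have hlog : ∀ w, p w * Real.log (p w / q w) = p w * Real.log (p w) +
        p w * Real.log (pA w.2.2) - p w * Real.log (pXA (w.1, w.2.2)) -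
          p w * Real.log (pBA w.2) := by
      intro w
      rcases (hp0 w).eq_or_lt with h | hpos
      · simp [← h]
      have h1 := hpos.trans_le (hpXA_le w)
      have h2 := hpos.trans_le (hpBA_le w)
      have h3 := hpos.trans_le (hpA_le w)
      simp only [hq]
      rw [Real.log_div hpos.ne' (by positivity), Real.log_mul h2.ne' (by positivity),
        Real.log_div h1.ne' h3.ne']
      ring
    simp_rw [hlog, Finset.sum_sub_distrib, Finset.sum_add_distrib]
    change entropy μ (fun ω => ((W ω).1, (W ω).2.2)) + entropy μ (fun ω => (W ω).2) -
      entropy μ (fun ω => W ω) - entropy μ (fun ω => (W ω).2.2) = _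
    rw [hXA, hBA, hXBA, hA']
    change -(∑ w, p w * Real.log (pXA (w.1, w.2.2))) + -(∑ w, p w * Real.log (pBA w.2)) -
      -(∑ w, p w * Real.log (p w)) - -(∑ w, p w * Real.log (pA w.2.2)) = _
    ring
  rw [hint, hcond, hmi]
  refine le_trans ?_
    (Real.le_sqrt_of_sq_le (sq_sum_abs_sub_le_two_mul_sum_log hp0 hq0 hpq hp1 hq1))
  rw [← Finset.sum_sub_distrib]
  refine (Finset.abs_sum_le_sum_abs _ _).trans (Finset.sum_le_sum fun w _ => ?_)
  rw [← sub_mul, abs_mul]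
  exact mul_le_of_le_one_right (abs_nonneg _) (hℓ _ _ _)
end

section
/- Lipschitz property of the Cauchy loss (used throughout the proofs of Proposition 2 and Lemma 1): Let c > 0 and let u, u' be vectors in a real normed vector space. Then |log(1 + ‖u‖²/c²) − log(1 + ‖u'‖²/c²)| ≤ (√2/c)‖u − u'‖. -/
theorem abs_log_one_add_sq_sub_le (x y : ℝ) :
    |Real.log (1 + x ^ 2) - Real.log (1 + y ^ 2)| ≤ |x - y| := by
  have hderiv (t : ℝ) :
      HasDerivAt (fun t : ℝ => Real.log (1 + t ^ 2)) (2 * t / (1 + t ^ 2)) t := by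
    have h : HasDerivAt (fun t : ℝ => 1 + t ^ 2) (2 * t) t := by
      simpa using (hasDerivAt_pow 2 t).const_add 1
    exact h.log (by positivity)
  have hbound (t : ℝ) : ‖2 * t / (1 + t ^ 2)‖ ≤ 1 := by
    have hpos : 0 < 1 + t ^ 2 := by positivity
    rw [Real.norm_eq_abs, abs_div, abs_of_pos hpos, div_le_one hpos, abs_le]
    constructor <;> nlinarith [sq_nonneg (t - 1), sq_nonneg (t + 1)]
  simpa using convex_univ.norm_image_sub_le_of_norm_hasDerivWithin_le
    (fun t _ => (hderiv t).hasDerivWithinAt) (fun t _ => hbound t)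
    (Set.mem_univ y) (Set.mem_univ x)

/-- Lipschitz property of the Cauchy loss (used throughout the proofs of
Proposition 2 and Lemma 1): for `c > 0` and vectors `u, u'` in a real normed
vector space, `|log(1 + ‖u‖²/c²) − log(1 + ‖u'‖²/c²)| ≤ (√2/c)‖u − u'‖`. -/
theorem cauchy_loss_lipschitz
    {E : Type*} [NormedAddCommGroup E] [NormedSpace ℝ E]
    (c : ℝ) (hc : 0 < c) (u u' : E) :
    |Real.log (1 + ‖u‖ ^ 2 / c ^ 2) - Real.log (1 + ‖u'‖ ^ 2 / c ^ 2)|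
      ≤ (Real.sqrt 2 / c) * ‖u - u'‖ := by
  simp only [← div_pow]
  calc
    |Real.log (1 + (‖u‖ / c) ^ 2) - Real.log (1 + (‖u'‖ / c) ^ 2)|
        ≤ |‖u‖ / c - ‖u'‖ / c| := abs_log_one_add_sq_sub_le _ _
    _ = 1 / c * |‖u‖ - ‖u'‖| := by
      rw [← sub_div, abs_div, abs_of_pos hc, one_div_mul_eq_div]
    _ ≤ Real.sqrt 2 / c * ‖u - u'‖ := by
      gcongr
      · exact Real.one_le_sqrt.2 one_le_two
      · exact abs_norm_sub_norm_le u u'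
end

section
/- Stability of the latent intact representation under a single-view perturbation (key step of Proposition 2): Let m ≥ 1, c > 0, C₂ > 0, and W_v ∈ ℝ^{D_v×d} for v = 1,…,m. Let z = (z^1,…,z^m) and ẑ = (ẑ^1,…,ẑ^m) be multi-view points with ẑ^v = z^v for all v ≠ k and ‖ẑ^k − z^k‖ = |τ|. Define R(z, y) = (1/m) Σ_{v=1}^m log(1 + ‖z^v − W_v y‖²/c²) for y ∈ ℝ^d. Suppose x minimizes y ↦ R(z, y) + C₂‖y‖² over ℝ^d, x̂ minimizes y ↦ R(ẑ, y) + C₂‖y‖² over ℝ^d, and y ↦ R(ẑ, y) is convex on the segment joining x and x̂. Then ‖x̂ − x‖² ≤ 4√2 |τ| / (m c C₂). -/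
theorem log_one_add_sq_sub_le {a b h : ℝ} (ha : 0 ≤ a) (hh : 0 ≤ h)
    (hab : a ≤ b + h) : Real.log (1 + a ^ 2) - Real.log (1 + b ^ 2) ≤ 2 * h := by
  have hexp : 1 + 2 * h + (2 * h) ^ 2 / 2 ≤ Real.exp (2 * h) :=
    Real.quadratic_le_exp_of_nonneg (by positivity)
  have hsq : a ^ 2 ≤ (b + h) ^ 2 := pow_le_pow_left₀ ha hab 2
  have hle : 1 + a ^ 2 ≤ (1 + b ^ 2) * Real.exp (2 * h) := by
    have hmul := mul_le_mul_of_nonneg_left hexp (by positivity : 0 ≤ 1 + b ^ 2)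
    nlinarith [mul_nonneg hh (sq_nonneg (b - 1)), mul_nonneg hh (sq_nonneg b),
      sq_nonneg (b * h), sq_nonneg h]
  have hlog := Real.log_le_log (by positivity) hle
  rw [Real.log_mul (by positivity) (Real.exp_ne_zero _), Real.log_exp] at hlog
  linarith

theorem log_one_add_norm_sq_div_sub_le {E : Type*} [SeminormedAddCommGroup E] {c : ℝ}
    (hc : 0 < c) (u w : E) :
    Real.log (1 + ‖u‖ ^ 2 / c ^ 2) - Real.log (1 + ‖w‖ ^ 2 / c ^ 2) ≤ 2 * (‖u - w‖ / c) := by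
  rw [← div_pow, ← div_pow]
  refine log_one_add_sq_sub_le (by positivity) (by positivity) ?_
  rw [← add_div]
  gcongr
  linarith [norm_sub_norm_le u w]

theorem norm_add_smul_sub_sq {E : Type*} [NormedAddCommGroup E] [InnerProductSpace ℝ E]
    (x y : E) (t : ℝ) :
    ‖x + t • (y - x)‖ ^ 2 =
      (1 - t) * ‖x‖ ^ 2 + t * ‖y‖ ^ 2 - t * (1 - t) * ‖y - x‖ ^ 2 := by
  rw [norm_add_sq_real, norm_smul, mul_pow, Real.norm_eq_abs, sq_abs, inner_smul_right,
    inner_sub_right, real_inner_self_eq_norm_sq, norm_sub_sq_real, real_inner_comm]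
  ring


/-- Stability of the latent intact representation under a single-view
perturbation (key step of Proposition 2): if `x` and `x'` are the regularized
Cauchy-loss minimizers for two multi-view points `z` and `z'` that agree on all
views except the `k`-th, where they differ by `‖z' k − z k‖ = |τ|`, and the
data-fit term `R(z', ·)` is convex on the segment joining `x` and `x'`, then
`‖x' − x‖² ≤ 4√2 |τ| / (m c C₂)`. -/
theorem intact_representation_stability
    {d m : ℕ} (hm : 1 ≤ m) {D : Fin m → ℕ}
    (c C₂ τ : ℝ) (hc : 0 < c) (hC₂ : 0 < C₂)
    (W : ∀ v : Fin m, Matrix (Fin (D v)) (Fin d) ℝ)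
    (z z' : ∀ v : Fin m, EuclideanSpace ℝ (Fin (D v)))
    (k : Fin m) (hzz' : ∀ v, v ≠ k → z' v = z v) (hτ : ‖z' k - z k‖ = |τ|)
    (R : (∀ v : Fin m, EuclideanSpace ℝ (Fin (D v))) → EuclideanSpace ℝ (Fin d) → ℝ)
    (hR : ∀ w y, R w y = (1 / (m : ℝ)) * ∑ v : Fin m,
      Real.log (1 + ‖w v - Matrix.toEuclideanLin (W v) y‖ ^ 2 / c ^ 2))
    (x x' : EuclideanSpace ℝ (Fin d))
    (hxmin : ∀ y, R z x + C₂ * ‖x‖ ^ 2 ≤ R z y + C₂ * ‖y‖ ^ 2)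
    (hx'min : ∀ y, R z' x' + C₂ * ‖x'‖ ^ 2 ≤ R z' y + C₂ * ‖y‖ ^ 2)
    (hconv : ∀ t ∈ Set.Icc (0 : ℝ) 1,
      R z' (x + t • (x' - x)) ≤ (1 - t) * R z' x + t * R z' x' ∧
      R z' (x' + t • (x - x')) ≤ (1 - t) * R z' x' + t * R z' x) :
    ‖x' - x‖ ^ 2 ≤ 4 * Real.sqrt 2 * |τ| / (m * c * C₂) := by
  have hm' : (0 : ℝ) < m := by exact_mod_cast hm
  have hswap (p q : ∀ v : Fin m, EuclideanSpace ℝ (Fin (D v)))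
      (hpq : ∀ v, v ≠ k → p v = q v) (hk : ‖p k - q k‖ = |τ|) (y) :
      R p y - R q y ≤ 1 / (m : ℝ) * (2 * (|τ| / c)) := by
    rw [hR, hR, ← mul_sub, ← Finset.sum_sub_distrib, Finset.sum_eq_single k]
    · gcongr
      have h := log_one_add_norm_sq_div_sub_le hc
        (p k - Matrix.toEuclideanLin (W k) y) (q k - Matrix.toEuclideanLin (W k) y)
      rwa [sub_sub_sub_cancel_right, hk] at h
    · intro v _ hv
      rw [hpq v hv, sub_self]
    · simp
  have h₁ := hswap z' z hzz' hτ x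
  have h₂ := hswap z z' (fun v hv => (hzz' v hv).symm) (by rw [norm_sub_rev, hτ]) x'
  have hmin := hx'min (x' + (1 / 4 : ℝ) • (x - x'))
  have hcv := (hconv (1 / 4) (by norm_num)).2
  rw [norm_add_smul_sub_sq, norm_sub_rev x x'] at hmin
  have hgap : C₂ * (3 / 4 * ‖x' - x‖ ^ 2) ≤ 4 * |τ| / (m * c) := by
    have heq : 1 / (m : ℝ) * (2 * (|τ| / c)) = 2 * |τ| / (m * c) := by
      field_simp
    have heq' : 4 * |τ| / (m * c) = 2 * (2 * |τ| / (m * c)) := by ring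
    rw [heq] at h₁ h₂
    rw [heq']
    linarith [hxmin x']
  have hsqrt : (4 / 3 : ℝ) ≤ Real.sqrt 2 := Real.le_sqrt_of_sq_le (by norm_num)
  rw [le_div_iff₀ (by positivity)] at hgap ⊢
  nlinarith [mul_le_mul_of_nonneg_right hsqrt (abs_nonneg τ)]
end
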